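/- arXiv:quant-ph/0007060 — 2 statements merged into one kernel-verified Lean document; each statement's English description precedes it below -/
import Mathlib

section
/- Let m > 0 and let G ⊆ ℝ³ be a nonempty open set. Then the ℂ-linear span of the set { H^{1/2}u + i·H^{−1/2}v : u, v smooth compactly supported real-valued functions on ℝ³ with support contained in G } is dense in L²(ℝ³;ℂ). (The one-particle content of the Reeh–Schlieder theorem for the standard localization scheme: the complex span of the Newton–Wigner images of Cauchy data localized in G is dense.) -/
open MeasureTheory Complex FourierTransform

noncomputable section

/-- Physical space `ℝ³`. -/
abbrev E3 : Type := EuclideanSpace ℝ (Fin 3)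

/-- The relativistic dispersion symbol `ω_m(ξ) = √(‖ξ‖² + m²)`. -/
def omegam (m : ℝ) (ξ : E3) : ℝ := Real.sqrt (‖ξ‖ ^ 2 + m ^ 2)

/-- The operator `H^s = (−∇² + m²)^{s/2}`, acting as the Fourier multiplier with symbol
`ω_m^s`: `H^s u = 𝓕⁻¹(ω_m^s · 𝓕u)`. -/
def Hpow (m s : ℝ) (u : E3 → ℂ) : E3 → ℂ :=
  𝓕⁻ (fun ξ => ((omegam m ξ ^ s : ℝ) : ℂ) * 𝓕 u ξ)

open Filter Topology

theorem analyticOnNhd_integral_mul_cexp {α : Type*} [MeasurableSpace α] {μ : Measure α}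
    {w : α → ℂ} {X : α → ℝ} (hX : Measurable X) {c : ℝ}
    (hw : Integrable (fun a => w a * (Real.exp (c * |X a|) : ℂ)) μ) :
    AnalyticOnNhd ℂ (fun z : ℂ => ∫ a, w a * cexp (I * z * X a) ∂μ) {z | |z.im| < c} := by
  have hopen : IsOpen {z : ℂ | |z.im| < c} :=
    isOpen_lt (continuous_abs.comp continuous_im) continuous_const
  have hwm : AEStronglyMeasurable w μ := by
    have h2 : AEStronglyMeasurable (fun a => (Real.exp (-(c * |X a|)) : ℂ)) μ :=
      (by fun_prop : Measurable fun a => (Real.exp (-(c * |X a|)) : ℂ)).aestronglyMeasurable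
    refine (hw.1.mul h2).congr (.of_forall fun a => ?_)
    simp only [Pi.mul_apply]
    rw [mul_assoc, ← ofReal_mul, ← Real.exp_add, add_neg_cancel]
    simp
  have hexp (z : ℂ) : AEStronglyMeasurable (fun a => cexp (I * z * X a)) μ :=
    (by fun_prop : Measurable fun a => cexp (I * z * X a)).aestronglyMeasurable
  have hnorm (z : ℂ) (a : α) : ‖cexp (I * z * X a)‖ = Real.exp (-z.im * X a) := by
    simp [norm_exp]
  refine DifferentiableOn.analyticOnNhd (fun z hz => ?_) hopen
  have hz' : |z.im| < c := hz
  set ε := (c - |z.im|) / 2 with hε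
  have hεpos : 0 < ε := by linarith
  have hball {x : ℂ} (hx : x ∈ Metric.ball z ε) : |x.im| ≤ c - ε := by
    have h1 : |x.im - z.im| < ε := by
      rw [← sub_im]; exact (abs_im_le_norm _).trans_lt (by simpa [dist_eq] using hx)
    have h2 : |x.im| ≤ |z.im| + |x.im - z.im| := by
      simpa using abs_add_le z.im (x.im - z.im)
    linarith
  have hle {b : ℝ} (hb : |b| ≤ c) (a : α) : Real.exp (-b * X a) ≤ Real.exp (c * |X a|) := by
    refine Real.exp_le_exp.2 ?_
    calc -b * X a ≤ |-b * X a| := le_abs_self _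
      _ = |b| * |X a| := by rw [abs_mul, abs_neg]
      _ ≤ _ := by gcongr
  refine (hasDerivAt_integral_of_dominated_loc_of_deriv_le (F := fun z a => w a * cexp (I * z * X a))
    (F' := fun z a => w a * (I * X a * cexp (I * z * X a)))
    (bound := fun a => ε⁻¹ * ‖w a * (Real.exp (c * |X a|) : ℂ)‖)
    (Metric.ball_mem_nhds z hεpos) ?_ ?_ ?_ ?_ ?_ ?_).2.differentiableAt.differentiableWithinAt
  · exact .of_forall fun x => hwm.mul (hexp x)
  · refine hw.mono (hwm.mul (hexp z)) (.of_forall fun a => ?_)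
    simp only [norm_mul, hnorm, norm_real, Real.norm_eq_abs, Real.abs_exp]
    exact mul_le_mul_of_nonneg_left (hle hz'.le a) (norm_nonneg _)
  · refine hwm.mul (AEStronglyMeasurable.mul ?_ (hexp z))
    exact (by fun_prop : Measurable fun a => I * (X a : ℂ)).aestronglyMeasurable
  · refine .of_forall fun a x hx => ?_
    simp only [norm_mul, hnorm, norm_real, Real.norm_eq_abs, Real.abs_exp, norm_I, one_mul]
    rw [mul_left_comm ε⁻¹]
    refine mul_le_mul_of_nonneg_left ?_ (norm_nonneg (w a))
    have h1 : ε * |X a| ≤ Real.exp (ε * |X a|) := by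
      linarith [Real.add_one_le_exp (ε * |X a|)]
    have h2 : Real.exp (-x.im * X a) ≤ Real.exp ((c - ε) * |X a|) := by
      refine Real.exp_le_exp.2 ?_
      calc -x.im * X a ≤ |-x.im * X a| := le_abs_self _
        _ = |x.im| * |X a| := by rw [abs_mul, abs_neg]
        _ ≤ _ := by gcongr; exact hball hx
    rw [le_inv_mul_iff₀ hεpos, ← mul_assoc]
    calc _ ≤ Real.exp (ε * |X a|) * Real.exp ((c - ε) * |X a|) := by gcongr
      _ = _ := by rw [← Real.exp_add]; ring_nf
  · exact hw.norm.const_mul _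
  · refine .of_forall fun a x _ => ?_
    have h1 : HasDerivAt (fun z : ℂ => I * z * X a) (I * X a) x := by
      simpa using ((hasDerivAt_id x).const_mul I).mul_const (X a : ℂ)
    convert! h1.cexp.const_mul (w a) using 1
    ring

theorem eq_zero_of_analyticOnNhd_strip {f : ℂ → ℂ} {c : ℝ} (hc : 0 < c)
    (hf : AnalyticOnNhd ℂ f {z | |z.im| < c}) (h0 : ∀ᶠ t : ℝ in 𝓝 0, f t = 0) (t : ℝ) :
    f t = 0 := by
  have hconv : Convex ℝ {z : ℂ | |z.im| < c} := by
    have h : {z : ℂ | |z.im| < c} = imLm ⁻¹' Set.Ioo (-c) c := by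
      ext z; simp [abs_lt]
    rw [h]
    exact (convex_Ioo _ _).linear_preimage imLm
  refine hf.eqOn_zero_of_preconnected_of_frequently_eq_zero (z₀ := 0) hconv.isPreconnected
    (by simpa using hc) ?_ (by simpa using hc)
  have htend : Tendsto (fun t : ℝ => (t : ℂ)) (𝓝[≠] 0) (𝓝[≠] 0) := by
    refine tendsto_nhdsWithin_iff.2 ⟨?_, ?_⟩
    · have : Tendsto (fun t : ℝ => (t : ℂ)) (𝓝 0) (𝓝 ((0 : ℝ) : ℂ)) := continuous_ofReal.tendsto 0
      exact (ofReal_zero ▸ this).mono_left nhdsWithin_le_nhds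
    · filter_upwards [self_mem_nhdsWithin] with t ht
      simpa using ht
  exact htend.frequently (h0.filter_mono nhdsWithin_le_nhds).frequently

theorem integral_mul_cos_eq_zero {α : Type*} [MeasurableSpace α] {μ : Measure α}
    {w : α → ℂ} {X : α → ℝ} (hX : Measurable X) {c : ℝ}
    (hw : Integrable (fun a => w a * (Real.exp (c * |X a|) : ℂ)) μ) (hw0 : Integrable w μ)
    (hmom : ∀ k : ℕ, ∫ a, w a * ((X a : ℂ) ^ (2 * k)) ∂μ = 0) {t : ℝ} (ht : |t| ≤ c) :
    ∫ a, w a * Complex.cos (t * X a) ∂μ = 0 := by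
  have hcosh (a : α) : HasSum (fun n : ℕ => ‖w a‖ * ((c * X a) ^ (2 * n) / (2 * n).factorial))
      (‖w a‖ * Real.cosh (c * X a)) := (Real.hasSum_cosh _).mul_left _
  have hs := hasSum_integral_of_dominated_convergence (μ := μ)
    (F := fun n a => w a * ((-1) ^ n * (t * X a : ℂ) ^ (2 * n) / (2 * n).factorial))
    (f := fun a => w a * Complex.cos (t * X a))
    (fun n a => ‖w a‖ * ((c * X a) ^ (2 * n) / (2 * n).factorial)) ?_ ?_ ?_ ?_ ?_
  · refine hs.unique ?_
    convert hasSum_zero with n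
    have h (a : α) : w a * ((-1) ^ n * (t * X a : ℂ) ^ (2 * n) / (2 * n).factorial) =
        ((-1) ^ n * (t : ℂ) ^ (2 * n) / (2 * n).factorial) * (w a * (X a : ℂ) ^ (2 * n)) := by
      ring
    simp_rw [h, integral_const_mul, hmom, mul_zero]
  · exact fun n => hw0.1.mul (by fun_prop :
      Measurable fun a => ((-1) ^ n * (t * X a : ℂ) ^ (2 * n) / (2 * n).factorial)).aestronglyMeasurable
  · refine fun n => .of_forall fun a => ?_
    rw [norm_mul, norm_div, norm_mul, norm_pow, norm_pow, norm_neg, norm_one, one_pow, one_mul,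
      norm_mul, norm_real, norm_real, norm_natCast, ← (even_two_mul n).pow_abs (c * X a), abs_mul]
    rw [Real.norm_eq_abs, Real.norm_eq_abs]
    have := ht.trans (le_abs_self c)
    gcongr ‖w a‖ * ((?_ * |X a|) ^ _ / _)
  · exact .of_forall fun a => (hcosh a).summable
  · simp_rw [fun a => (hcosh a).tsum_eq]
    refine hw.mono (hw0.1.norm.mul (by fun_prop :
      Measurable fun a => Real.cosh (c * X a)).aestronglyMeasurable) (.of_forall fun a => ?_)
    simp only [norm_mul, norm_real, Real.norm_eq_abs, Real.abs_exp]
    refine mul_le_mul (abs_norm _).le ?_ (abs_nonneg _) (norm_nonneg _)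
    have hc : 0 ≤ c := (abs_nonneg t).trans ht
    rw [abs_of_pos (Real.cosh_pos _), ← Real.cosh_abs, abs_mul, abs_of_nonneg hc, Real.cosh_eq]
    have : Real.exp (-(c * |X a|)) ≤ Real.exp (c * |X a|) := by
      have : 0 ≤ c * |X a| := by positivity
      gcongr; linarith
    linarith
  · exact .of_forall fun a => (Complex.hasSum_cos _).mul_left _

theorem integral_gaussian_mul_cos (x : ℝ) :
    ∫ s : ℝ, (Real.exp (-s ^ 2) : ℂ) * Complex.cos (s * x) =
      (Real.pi : ℂ) ^ (1 / 2 : ℂ) * (Real.exp (-(x ^ 2 / 4)) : ℂ) := by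
  have h (y : ℝ) := fourierIntegral_gaussian (b := 1) (by simp) (y : ℂ)
  have hi (y : ℝ) : Integrable fun s : ℝ => cexp (I * y * s) * cexp (-1 * s ^ 2) := by
    have := integrable_cexp_quadratic' (b := -1) (by simp) (I * y) 0
    refine this.congr (.of_forall fun s => ?_)
    simp only [← Complex.exp_add]; congr 1; ring
  have h2 : ∀ s : ℝ, (Real.exp (-s ^ 2) : ℂ) * Complex.cos (s * x) =
      (1 / 2 : ℂ) * (cexp (I * x * s) * cexp (-1 * s ^ 2) +
        cexp (I * (-x : ℝ) * s) * cexp (-1 * s ^ 2)) := by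
    intro s
    rw [Complex.cos, ofReal_exp]
    push_cast
    ring_nf
  simp_rw [h2]
  rw [integral_const_mul, integral_add (hi x) (hi (-x)), h, h]
  push_cast
  ring_nf

theorem integral_mul_exp_neg_sq_eq_zero {α : Type*} [MeasurableSpace α] {μ : Measure α} [SFinite μ]
    {w : α → ℂ} {X : α → ℝ} (hX : Measurable X) {c : ℝ} (hc : 0 < c)
    (hw : Integrable (fun a => w a * (Real.exp (c * |X a|) : ℂ)) μ) (hw0 : Integrable w μ)
    (hmom : ∀ k : ℕ, ∫ a, w a * ((X a : ℂ) ^ (2 * k)) ∂μ = 0) :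
    ∫ a, w a * (Real.exp (-(X a ^ 2 / 4)) : ℂ) ∂μ = 0 := by
  have hI := analyticOnNhd_integral_mul_cexp hX hw
  have hbd (t : ℝ) : Integrable (fun a => w a * cexp (I * t * X a)) μ := by
    refine hw0.mul_bdd (c := 1) (by fun_prop : Measurable fun a => cexp (I * t * X a)).aestronglyMeasurable
      (.of_forall fun a => ?_)
    simp [norm_exp]
  have hcos (t : ℝ) : ∫ a, w a * Complex.cos (t * X a) ∂μ = (1 / 2 : ℂ) *
      (∫ a, w a * cexp (I * t * X a) ∂μ + ∫ a, w a * cexp (I * (-t : ℂ) * X a) ∂μ) := by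
    have := hbd (-t)
    push_cast at this
    rw [← integral_add (hbd t) this, ← integral_const_mul]
    congr 1 with a
    rw [Complex.cos]
    ring_nf
  have hzero (t : ℝ) : ∫ a, w a * Complex.cos (t * X a) ∂μ = 0 := by
    rw [hcos]
    refine eq_zero_of_analyticOnNhd_strip (f := fun z => (1 / 2 : ℂ) *
      (∫ a, w a * cexp (I * z * X a) ∂μ + ∫ a, w a * cexp (I * (-z) * X a) ∂μ)) hc ?_ ?_ t
    · refine analyticOnNhd_const.mul (hI.add ?_)
      exact hI.comp analyticOnNhd_id.neg (fun z hz => by simpa using hz)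
    · filter_upwards [Metric.closedBall_mem_nhds (0 : ℝ) hc] with s hs
      rw [← hcos]
      exact integral_mul_cos_eq_zero hX hw hw0 hmom (by simpa using hs)
  have hg : Integrable fun s : ℝ => (Real.exp (-s ^ 2) : ℂ) := by
    simpa using (integrable_exp_neg_mul_sq (b := 1) one_pos).ofReal (𝕜 := ℂ)
  have hprod : Integrable (Function.uncurry fun (a : α) (s : ℝ) =>
      w a * ((Real.exp (-s ^ 2) : ℂ) * Complex.cos (s * X a))) (μ.prod volume) := by
    have h1 := (hw0.mul_prod hg).mul_bdd (c := 1)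
      (g := fun p : α × ℝ => Complex.cos (p.2 * X p.1))
      (by fun_prop : Measurable fun p : α × ℝ => Complex.cos (p.2 * X p.1)).aestronglyMeasurable
      (.of_forall fun p => ?_)
    · refine h1.congr (.of_forall fun p => ?_)
      simp [Function.uncurry, mul_assoc]
    · rw [← ofReal_mul, ← ofReal_cos, norm_real]
      exact Real.abs_cos_le_one _
  have hswap := integral_integral_swap hprod
  simp_rw [integral_const_mul, integral_gaussian_mul_cos] at hswap
  have h3 (s : ℝ) : ∫ a, w a * ((Real.exp (-s ^ 2) : ℂ) * Complex.cos (s * X a)) ∂μ = 0 := by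
    simp_rw [mul_left_comm (w _), integral_const_mul, hzero, mul_zero]
  simp_rw [h3, mul_left_comm (w _), integral_const_mul, integral_zero] at hswap
  refine (mul_eq_zero.1 hswap).resolve_left ?_
  simp [Complex.cpow_eq_zero_iff, Real.pi_ne_zero]
/-- A nonnegative bump function supported in `[0, 1]`, of Gevrey class 2. -/
def unitBump (x : ℝ) : ℂ := ((expNegInvGlue x * expNegInvGlue (1 - x) : ℝ) : ℂ)

theorem contDiff_unitBump {n : ℕ∞} : ContDiff ℝ n unitBump :=
  ofRealCLM.contDiff.comp (expNegInvGlue.contDiff.mul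
    (expNegInvGlue.contDiff.comp (contDiff_const.sub contDiff_id)))

theorem unitBump_eq_zero {x : ℝ} (hx : x ∉ Set.Icc (0 : ℝ) 1) : unitBump x = 0 := by
  rcases not_and_or.1 hx with h | h
  · simp [unitBump, expNegInvGlue.zero_of_nonpos (not_le.1 h).le]
  · simp [unitBump, expNegInvGlue.zero_of_nonpos (sub_nonpos.2 (not_le.1 h).le)]

theorem tsupport_unitBump_subset : tsupport unitBump ⊆ Set.Icc 0 1 :=
  closure_minimal (fun _ hx => by_contra fun h => hx (unitBump_eq_zero h)) isClosed_Icc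

theorem iteratedDeriv_comp_ofReal {f : ℂ → ℂ} {s : Set ℝ} (hs : IsOpen s)
    (hf : ∀ x ∈ s, AnalyticAt ℂ f x) (n : ℕ) :
    ∀ x ∈ s, iteratedDeriv n (fun t : ℝ => f t) x = iteratedDeriv n f x := by
  induction n with
  | zero => simp
  | succ n ih =>
    intro x hx
    rw [iteratedDeriv_succ, iteratedDeriv_succ]
    have h : iteratedDeriv n (fun t : ℝ => f t) =ᶠ[𝓝 x] fun t : ℝ => iteratedDeriv n f t := by
      filter_upwards [hs.mem_nhds hx] with t ht using ih t ht
    rw [h.deriv_eq]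
    have hd : DifferentiableAt ℂ (iteratedDeriv n f) x := by
      rw [iteratedDeriv_eq_iterate]
      exact ((hf x hx).iterated_deriv n).differentiableAt
    exact hd.hasDerivAt.comp_ofReal.deriv

theorem re_inv_ge_of_norm_sub_le {x : ℝ} (hx : 0 < x) {z : ℂ} (hz : ‖z - x‖ ≤ x / 2) :
    z ≠ 0 ∧ 2 / (9 * x) ≤ (z⁻¹).re := by
  have h1 : x / 2 ≤ z.re := by
    have := (abs_re_le_norm (z - x)).trans hz
    rw [sub_re, ofReal_re, abs_le] at this
    linarith
  have h2 : ‖z‖ ≤ 3 / 2 * x := by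
    have := norm_add_le (z - x) x
    rw [sub_add_cancel, norm_real, Real.norm_of_nonneg hx.le] at this
    linarith
  have h0 : z ≠ 0 := by rintro rfl; simp at h1; linarith
  refine ⟨h0, ?_⟩
  have hpos : 0 < normSq z := normSq_pos.2 h0
  rw [inv_re, div_le_div_iff₀ (by positivity) hpos, normSq_eq_norm_sq]
  nlinarith [mul_le_mul h2 h2 (norm_nonneg z) (by positivity)]

theorem norm_iteratedDeriv_unitBump_le (k : ℕ) {x : ℝ} (hx : x ∈ Set.Ioo (0 : ℝ) 1) :
    ‖iteratedDeriv k unitBump x‖ ≤ (k.factorial : ℝ) ^ 2 * 9 ^ k := by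
  set g : ℂ → ℂ := fun z => cexp (-z⁻¹) * cexp (-(1 - z)⁻¹) with hg
  have hgan {z : ℂ} (h0 : z ≠ 0) (h1 : 1 - z ≠ 0) : AnalyticAt ℂ g z := by fun_prop (disch := assumption)
  have hbg : unitBump =ᶠ[𝓝 x] fun t : ℝ => g t := by
    filter_upwards [isOpen_Ioo.mem_nhds hx] with t ht
    simp [unitBump, hg, expNegInvGlue, not_le.2 ht.1, not_le.2 ht.2]
  rw [hbg.iteratedDeriv_eq, iteratedDeriv_comp_ofReal isOpen_Ioo ?_ k x hx]
  swap
  · refine fun t ht => hgan ?_ ?_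
    · exact_mod_cast ht.1.ne'
    · exact_mod_cast (sub_pos.2 ht.2).ne'
  set d := min x (1 - x) with hd
  have hdpos : 0 < d := lt_min hx.1 (sub_pos.2 hx.2)
  have key {z : ℂ} (hz : ‖z - x‖ ≤ d / 2) :
      z ≠ 0 ∧ 1 - z ≠ 0 ∧ 2 / (9 * d) ≤ (z⁻¹).re + ((1 - z)⁻¹).re := by
    obtain ⟨h0, h0'⟩ := re_inv_ge_of_norm_sub_le hx.1 (z := z)
      (hz.trans (by linarith [min_le_left x (1 - x)]))
    obtain ⟨h1, h1'⟩ := re_inv_ge_of_norm_sub_le (sub_pos.2 hx.2) (z := 1 - z) (by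
      have : (1 - z) - ((1 - x : ℝ) : ℂ) = -(z - x) := by push_cast; ring
      rw [this, norm_neg]
      exact hz.trans (by linarith [min_le_right x (1 - x)]))
    refine ⟨h0, h1, ?_⟩
    have p0 : 0 < 2 / (9 * x) := by have := hx.1; positivity
    have p1 : 0 < 2 / (9 * (1 - x)) := by have := sub_pos.2 hx.2; positivity
    rcases min_choice x (1 - x) with h | h <;> rw [hd, h] <;> linarith
  have hcauchy := norm_iteratedDeriv_le_of_forall_mem_sphere_norm_le (f := g) (c := x)
    (R := d / 2) (C := Real.exp (-(2 / (9 * d)))) k (by positivity) ?_ ?_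
  · refine hcauchy.trans ?_
    have h := Real.pow_div_factorial_le_exp (2 / (9 * d)) (by positivity) k
    rw [div_le_iff₀ (by positivity)] at h
    have e1 : (k.factorial : ℝ) * Real.exp (-(2 / (9 * d))) / (d / 2) ^ k =
        k.factorial * 9 ^ k * ((2 / (9 * d)) ^ k * Real.exp (-(2 / (9 * d)))) := by
      have : (2 / (9 * d)) ^ k * 9 ^ k = 1 / (d / 2) ^ k := by
        rw [← mul_pow, ← one_div_pow]; congr 1; field_simp
      rw [mul_assoc _ (9 ^ k), mul_left_comm (9 ^ k), ← mul_assoc, mul_comm (9 ^ k), div_eq_mul_one_div,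
        ← this]
      ring
    rw [e1]
    have h3 : (2 / (9 * d)) ^ k * Real.exp (-(2 / (9 * d))) ≤ k.factorial := by
      rw [Real.exp_neg, ← div_eq_mul_inv, div_le_iff₀ (Real.exp_pos _)]
      linarith [h]
    calc _ ≤ k.factorial * 9 ^ k * (k.factorial : ℝ) := by gcongr
      _ = _ := by ring
  · have hdiff : DifferentiableOn ℂ g (Metric.closedBall x (d / 2)) := fun z hz => by
      obtain ⟨h0, h1, -⟩ := key (by simpa [dist_eq] using hz)
      exact (hgan h0 h1).differentiableAt.differentiableWithinAt
    exact hdiff.diffContOnCl_ball subset_rfl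
  · intro z hz
    obtain ⟨-, -, h⟩ := key (z := z) (by rw [← dist_eq]; exact hz.le)
    simp only [hg]
    rw [← Complex.exp_add, norm_exp]
    refine Real.exp_le_exp.2 ?_
    simp only [add_re, neg_re]
    linarith

theorem support_iteratedDeriv_unitBump_subset (k : ℕ) :
    Function.support (iteratedDeriv k unitBump) ⊆ Set.Icc 0 1 := by
  refine fun x hx => tsupport_unitBump_subset (by_contra fun h => hx ?_)
  rw [(notMem_tsupport_iff_eventuallyEq.1 h).iteratedDeriv_eq]
  simp

theorem integrable_iteratedDeriv_unitBump (k : ℕ) : Integrable (iteratedDeriv k unitBump) := by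
  refine ((contDiff_unitBump (n := ⊤)).continuous_iteratedDeriv k
    (by exact_mod_cast le_top)).integrable_of_hasCompactSupport ?_
  refine HasCompactSupport.of_support_subset_isCompact (isCompact_Icc (a := (0 : ℝ)) (b := 1)) ?_
  exact support_iteratedDeriv_unitBump_subset k

theorem integral_norm_iteratedDeriv_unitBump_le (k : ℕ) :
    ∫ x, ‖iteratedDeriv k unitBump x‖ ≤ (k.factorial : ℝ) ^ 2 * 9 ^ k := by
  have h1 : ∫ x, ‖iteratedDeriv k unitBump x‖ =
      ∫ x in Set.Ioo (0 : ℝ) 1, ‖iteratedDeriv k unitBump x‖ := by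
    rw [← integral_Icc_eq_integral_Ioo, setIntegral_eq_integral_of_forall_compl_eq_zero]
    intro x hx
    rw [norm_eq_zero]
    exact Function.notMem_support.1 fun h => hx (support_iteratedDeriv_unitBump_subset k h)
  rw [h1]
  have := norm_setIntegral_le_of_norm_le_const (μ := volume) (s := Set.Ioo (0 : ℝ) 1)
    (f := fun x => ‖iteratedDeriv k unitBump x‖) (C := (k.factorial : ℝ) ^ 2 * 9 ^ k) (by simp)
    (fun x hx => by simpa using norm_iteratedDeriv_unitBump_le k hx)
  simp at this
  exact (le_abs_self _).trans this

theorem norm_fourier_unitBump_le (ξ : ℝ) :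
    ‖𝓕 unitBump ξ‖ ≤ 4 * Real.exp (-(Real.sqrt |ξ| / 2)) := by
  have hk (k : ℕ) : (2 * Real.pi * |ξ|) ^ k * ‖𝓕 unitBump ξ‖ ≤ (k.factorial : ℝ) ^ 2 * 9 ^ k := by
    have h := congrFun (Real.fourier_iteratedDeriv (N := ⊤) (n := k) contDiff_unitBump
      (fun n _ => integrable_iteratedDeriv_unitBump n) le_top) ξ
    have h2 : ‖𝓕 (iteratedDeriv k unitBump) ξ‖ ≤ ∫ x, ‖iteratedDeriv k unitBump x‖ :=
      VectorFourier.norm_fourierIntegral_le_integral_norm _ _ _ _ _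
    rw [h] at h2
    refine le_trans (le_of_eq ?_) (h2.trans (integral_norm_iteratedDeriv_unitBump_le k))
    simp [abs_of_pos Real.pi_pos]
  set y := Real.sqrt |ξ| / 2 with hy
  have hyy : y ^ 2 = |ξ| / 4 := by rw [hy, div_pow, Real.sq_sqrt (abs_nonneg _)]; norm_num
  have hy0 : 0 ≤ y := by positivity
  have hterm (k : ℕ) : y ^ (2 * k) / (2 * k).factorial * ‖𝓕 unitBump ξ‖ ≤ (1 / 2) ^ k := by
    have hfac : (k.factorial : ℝ) ^ 2 ≤ (2 * k).factorial := by
      have := Nat.le_of_dvd (Nat.factorial_pos _) (Nat.factorial_mul_factorial_dvd_factorial_add k k)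
      rw [two_mul, sq]; exact_mod_cast this
    rw [div_mul_eq_mul_div, div_le_iff₀ (by positivity), pow_mul, hyy]
    have h18 : |ξ| / 4 ≤ 2 * Real.pi * |ξ| / 18 := by
      have := Real.pi_gt_three
      nlinarith [abs_nonneg ξ]
    calc (|ξ| / 4) ^ k * ‖𝓕 unitBump ξ‖ ≤ (2 * Real.pi * |ξ| / 18) ^ k * ‖𝓕 unitBump ξ‖ := by gcongr
      _ = (1 / 18) ^ k * ((2 * Real.pi * |ξ|) ^ k * ‖𝓕 unitBump ξ‖) := by
          rw [← mul_assoc, ← mul_pow]; congr 2; ring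
      _ ≤ (1 / 18) ^ k * ((k.factorial : ℝ) ^ 2 * 9 ^ k) := mul_le_mul_of_nonneg_left (hk k) (by positivity)
      _ = (1 / 2) ^ k * (k.factorial : ℝ) ^ 2 := by
          rw [mul_comm _ (9 ^ k : ℝ), ← mul_assoc, ← mul_pow]; norm_num
      _ ≤ _ := by gcongr
  have hcosh : Real.cosh y * ‖𝓕 unitBump ξ‖ ≤ 2 := by
    refine hasSum_le hterm ((Real.hasSum_cosh y).mul_right _) ?_
    exact hasSum_geometric_two
  have : Real.exp y / 2 ≤ Real.cosh y := by
    rw [Real.cosh_eq]; linarith [Real.exp_pos (-y)]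
  rw [Real.exp_neg, ← div_eq_mul_inv, le_div_iff₀ (Real.exp_pos _)]
  nlinarith [norm_nonneg (𝓕 unitBump ξ)]

theorem continuous_fourier_unitBump : Continuous (𝓕 unitBump) := by
  have h : Integrable unitBump := by simpa using integrable_iteratedDeriv_unitBump 0
  exact VectorFourier.fourierIntegral_continuous Real.continuous_fourierChar
    (by fun_prop) h

theorem fourier_unitBump_zero_ne_zero : 𝓕 unitBump 0 ≠ 0 := by
  have h : Integrable unitBump := by simpa using integrable_iteratedDeriv_unitBump 0
  rw [Real.fourier_real_eq]
  simp only [mul_zero, neg_zero, AddChar.map_zero_eq_one, one_smul, unitBump]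
  rw [integral_complex_ofReal, ofReal_ne_zero]
  refine ((integral_pos_iff_support_of_nonneg
    (fun x => mul_nonneg (expNegInvGlue.nonneg _) (expNegInvGlue.nonneg _)) ?_).2 ?_).ne'
  · simpa [unitBump] using h.re
  · refine lt_of_lt_of_le ?_ (measure_mono (s := Set.Ioo (0 : ℝ) 1) fun x hx => ?_)
    · simp
    · exact (mul_pos (expNegInvGlue.pos_of_pos hx.1)
        (expNegInvGlue.pos_of_pos (sub_pos.2 hx.2))).ne'

/-- The product bump function on `ℝ³` with corner `p` and side length `ε`. -/
def cubeBump (ε : ℝ) (p x : E3) : ℂ := ∏ i, unitBump ((x i - p i) / ε)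

theorem contDiff_cubeBump (ε : ℝ) (p : E3) {n : ℕ∞} : ContDiff ℝ n (cubeBump ε p) :=
  contDiff_prod fun i _ => contDiff_unitBump.comp (by fun_prop)

theorem tsupport_cubeBump_subset {ε : ℝ} (hε : 0 < ε) (p : E3) :
    tsupport (cubeBump ε p) ⊆ Metric.closedBall p (2 * ε) := by
  refine closure_minimal (fun x hx => ?_) Metric.isClosed_closedBall
  have h (i : Fin 3) : |x i - p i| ≤ ε := by
    have hi : (x i - p i) / ε ∈ Set.Icc (0 : ℝ) 1 := by
      by_contra h
      exact hx (Finset.prod_eq_zero (Finset.mem_univ i) (unitBump_eq_zero h))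
    have h2 := (div_le_one hε).1 hi.2
    have h1 : 0 ≤ x i - p i := by simpa [div_mul_cancel₀ _ hε.ne'] using mul_nonneg hi.1 hε.le
    rwa [abs_of_nonneg h1]
  rw [mem_closedBall_iff_norm, EuclideanSpace.norm_eq]
  refine Real.sqrt_le_iff.2 ⟨by positivity, ?_⟩
  simp only [Fin.sum_univ_three, PiLp.sub_apply, Real.norm_eq_abs]
  have hs (i : Fin 3) : |x i - p i| ^ 2 ≤ ε ^ 2 := by gcongr; exact h i
  nlinarith [hs 0, hs 1, hs 2, sq_nonneg ε]

theorem integral_cexp_mul_unitBump {ε : ℝ} (hε : 0 < ε) (p ξ : ℝ) :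
    ∫ v : ℝ, cexp (((-2 * Real.pi * (v * ξ) : ℝ) : ℂ) * I) * unitBump ((v - p) / ε) =
      cexp (I * ((-(2 * Real.pi * (p * ξ)) : ℝ) : ℂ)) * (ε * 𝓕 unitBump (ε * ξ)) := by
  have h1 (v : ℝ) : cexp (((-2 * Real.pi * (v * ξ) : ℝ) : ℂ) * I) * unitBump ((v - p) / ε) =
      cexp (I * ((-(2 * Real.pi * (p * ξ)) : ℝ) : ℂ)) *
        (fun s : ℝ => cexp (((-2 * Real.pi * s * (ε * ξ) : ℝ) : ℂ) * I) • unitBump s)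
          ((v - p) / ε) := by
    simp only [smul_eq_mul]
    rw [← mul_assoc (cexp (I * _)) (cexp _), ← Complex.exp_add]
    congr 2
    have : (ε : ℂ) ≠ 0 := by exact_mod_cast hε.ne'
    push_cast
    field_simp
    ring
  simp_rw [h1]
  rw [integral_const_mul, integral_sub_right_eq_self (fun v : ℝ =>
      (fun s : ℝ => cexp (((-2 * Real.pi * s * (ε * ξ) : ℝ) : ℂ) * I) • unitBump s) (v / ε)) p,
    Measure.integral_comp_div (fun s : ℝ => cexp (((-2 * Real.pi * s * (ε * ξ) : ℝ) : ℂ) * I) •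
      unitBump s) ε, ← Real.fourier_real_eq_integral_exp_smul, abs_of_pos hε, real_smul]

theorem fourier_cubeBump {ε : ℝ} (hε : 0 < ε) (p ξ : E3) :
    𝓕 (cubeBump ε p) ξ = cexp (I * ((-(2 * Real.pi * inner ℝ p ξ) : ℝ) : ℂ)) *
      ∏ i, ((ε : ℂ) * 𝓕 unitBump (ε * ξ i)) := by
  have hinner (v : E3) : inner ℝ v ξ = ∑ i, v i * ξ i := by
    simp [PiLp.inner_apply, mul_comm]
  rw [Real.fourier_eq', ← (PiLp.volume_preserving_toLp (Fin 3)).integral_comp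
    (MeasurableEquiv.toLp 2 (Fin 3 → ℝ)).measurableEmbedding]
  have h (v : Fin 3 → ℝ) : cexp (((-2 * Real.pi * inner ℝ (WithLp.toLp 2 v) ξ : ℝ) : ℂ) * I) •
      cubeBump ε p (WithLp.toLp 2 v) =
      ∏ i, (cexp (((-2 * Real.pi * (v i * ξ i) : ℝ) : ℂ) * I) * unitBump ((v i - p i) / ε)) := by
    rw [Finset.prod_mul_distrib, ← Complex.exp_sum, cubeBump, hinner, smul_eq_mul]
    congr 2
    rw [← Finset.sum_mul, ← ofReal_sum, Finset.mul_sum]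
  simp_rw [h]
  rw [integral_fintype_prod_volume_eq_prod (fun i (s : ℝ) =>
    cexp (((-2 * Real.pi * (s * ξ i) : ℝ) : ℂ) * I) * unitBump ((s - p i) / ε))]
  simp_rw [integral_cexp_mul_unitBump hε]
  rw [Finset.prod_mul_distrib, ← Complex.exp_sum, ← Finset.mul_sum, ← ofReal_sum, hinner,
    Finset.sum_neg_distrib, ← Finset.mul_sum]

theorem norm_fourier_cubeBump_le {ε : ℝ} (hε : 0 < ε) (p ξ : E3) :
    ‖𝓕 (cubeBump ε p) ξ‖ ≤ (4 * ε) ^ 3 * Real.exp (-(Real.sqrt (ε * ‖ξ‖) / 2)) := by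
  rw [fourier_cubeBump hε, norm_mul, mul_comm I, norm_exp_ofReal_mul_I, one_mul, norm_prod]
  have h1 : ∏ i, ‖(ε : ℂ) * 𝓕 unitBump (ε * ξ i)‖ ≤
      ∏ i, (4 * ε * Real.exp (-(Real.sqrt (ε * |ξ i|) / 2))) := by
    refine Finset.prod_le_prod (fun i _ => norm_nonneg _) fun i _ => ?_
    have := norm_fourier_unitBump_le (ε * ξ i)
    rw [abs_mul, abs_of_pos hε] at this
    rw [norm_mul, norm_real, Real.norm_of_nonneg hε.le]
    nlinarith
  refine h1.trans ?_
  rw [Finset.prod_mul_distrib, Finset.prod_const, ← Real.exp_sum]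
  simp only [Finset.card_univ, Fintype.card_fin]
  gcongr
  rw [Finset.sum_neg_distrib, neg_le_neg_iff, ← Finset.sum_div]
  gcongr
  refine Real.sqrt_le_iff.2 ⟨Finset.sum_nonneg fun i _ => Real.sqrt_nonneg _, ?_⟩
  have h2 : ‖ξ‖ ≤ ∑ i, |ξ i| := by
    rw [EuclideanSpace.norm_eq]
    refine Real.sqrt_le_iff.2 ⟨Finset.sum_nonneg fun i _ => abs_nonneg _, ?_⟩
    simp only [Real.norm_eq_abs]
    exact Finset.sum_sq_le_sq_sum_of_nonneg fun i _ => abs_nonneg _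
  calc ε * ‖ξ‖ ≤ ε * ∑ i, |ξ i| := by gcongr
    _ = ∑ i, (Real.sqrt (ε * |ξ i|)) ^ 2 := by
      rw [Finset.mul_sum]
      exact Finset.sum_congr rfl fun i _ => (Real.sq_sqrt (by positivity)).symm
    _ ≤ _ := Finset.sum_sq_le_sq_sum_of_nonneg fun i _ => Real.sqrt_nonneg _

theorem eventually_fourier_cubeBump_ne_zero (p ξ : E3) :
    ∀ᶠ ε in 𝓝[>] (0 : ℝ), 𝓕 (cubeBump ε p) ξ ≠ 0 := by
  have h (i : Fin 3) : ∀ᶠ ε in 𝓝[>] (0 : ℝ), 𝓕 unitBump (ε * ξ i) ≠ 0 := by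
    have hc : ContinuousAt (fun ε : ℝ => 𝓕 unitBump (ε * ξ i)) 0 :=
      (continuous_fourier_unitBump.comp (continuous_id.mul continuous_const)).continuousAt
    refine (hc.eventually_ne ?_).filter_mono nhdsWithin_le_nhds
    simpa using fourier_unitBump_zero_ne_zero
  filter_upwards [eventually_all.2 h, self_mem_nhdsWithin] with ε hi hε
  rw [fourier_cubeBump hε]
  refine mul_ne_zero (Complex.exp_ne_zero _) (Finset.prod_ne_zero_iff.2 fun i _ => ?_)
  exact mul_ne_zero (by exact_mod_cast (ne_of_gt hε)) (hi i)

open scoped SchwartzMap LineDeriv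

theorem omegam_pos {m : ℝ} (hm : 0 < m) (ξ : E3) : 0 < omegam m ξ :=
  Real.sqrt_pos.2 (by positivity)

theorem omegam_sq (m : ℝ) (ξ : E3) : omegam m ξ ^ 2 = ‖ξ‖ ^ 2 + m ^ 2 :=
  Real.sq_sqrt (by positivity)

theorem continuous_omegam (m : ℝ) : Continuous (omegam m) := by
  unfold omegam
  fun_prop

theorem omegam_le {m : ℝ} (hm : 0 < m) (ξ : E3) : omegam m ξ ≤ ‖ξ‖ + m :=
  Real.sqrt_le_iff.2 ⟨by positivity, by nlinarith [norm_nonneg ξ]⟩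

theorem norm_le_omegam (m : ℝ) (ξ : E3) : ‖ξ‖ ≤ omegam m ξ :=
  Real.le_sqrt_of_sq_le (by nlinarith [sq_nonneg m])

theorem le_omegam (m : ℝ) (ξ : E3) : m ≤ omegam m ξ :=
  Real.le_sqrt_of_sq_le (by nlinarith [sq_nonneg ‖ξ‖])

theorem hasTemperateGrowth_omegam_rpow {m : ℝ} (hm : 0 < m) (s : ℝ) :
    Function.HasTemperateGrowth fun ξ : E3 => ((omegam m ξ ^ s : ℝ) : ℂ) := by
  have h : (fun ξ : E3 => omegam m ξ ^ s) =
      fun ξ : E3 => m ^ s * (fun η : E3 => (1 + ‖η‖ ^ 2) ^ (s / 2)) (m⁻¹ • ξ) := by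
    ext ξ
    have h1 : omegam m ξ = m * (1 + ‖m⁻¹ • ξ‖ ^ 2) ^ (1 / 2 : ℝ) := by
      rw [omegam, ← Real.sqrt_eq_rpow, ← Real.sqrt_sq hm.le, ← Real.sqrt_mul (by positivity),
        Real.sqrt_sq hm.le, norm_smul, mul_pow, norm_inv, Real.norm_of_nonneg hm.le]
      congr 1
      field_simp
      ring
    rw [h1, Real.mul_rpow hm.le (by positivity), ← Real.rpow_mul (by positivity)]
    congr 2
    ring
  refine Function.HasTemperateGrowth.comp (g := fun x : ℝ => (x : ℂ)) (by fun_prop) ?_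
  rw [h]
  refine (Function.HasTemperateGrowth.const _).mul ?_
  exact (Function.hasTemperateGrowth_one_add_norm_sq_rpow E3 (s / 2)).comp
    (ContinuousLinearMap.hasTemperateGrowth (m⁻¹ • ContinuousLinearMap.id ℝ E3))

/-- The operator `H^s` on Schwartz functions. -/
def HpowSchwartz (m s : ℝ) (u : 𝓢(E3, ℂ)) : 𝓢(E3, ℂ) :=
  𝓕⁻ (SchwartzMap.smulLeftCLM ℂ (fun ξ : E3 => ((omegam m ξ ^ s : ℝ) : ℂ)) (𝓕 u))

theorem coe_HpowSchwartz {m : ℝ} (hm : 0 < m) (s : ℝ) (u : 𝓢(E3, ℂ)) :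
    ⇑(HpowSchwartz m s u) = Hpow m s u := by
  rw [HpowSchwartz, SchwartzMap.fourierInv_coe,
    SchwartzMap.smulLeftCLM_apply (hasTemperateGrowth_omegam_rpow hm s), SchwartzMap.fourier_coe]
  rfl

theorem inner_toLp_HpowSchwartz {m : ℝ} (hm : 0 < m) (s : ℝ)
    (f : Lp ℂ 2 (volume : Measure E3)) (u : 𝓢(E3, ℂ)) :
    inner ℂ f ((HpowSchwartz m s u).toLp 2 volume) =
      ∫ ξ, (starRingEnd ℂ) ((𝓕 f : Lp ℂ 2 (volume : Measure E3)) ξ) *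
        (((omegam m ξ ^ s : ℝ) : ℂ) * 𝓕 (u : E3 → ℂ) ξ) := by
  rw [← Lp.inner_fourier_eq, SchwartzMap.toLp_fourier_eq, HpowSchwartz,
    FourierTransform.fourier_fourierInv_eq, L2.inner_def]
  refine integral_congr_ae ?_
  filter_upwards [SchwartzMap.coeFn_toLp (SchwartzMap.smulLeftCLM ℂ
    (fun ξ : E3 => ((omegam m ξ ^ s : ℝ) : ℂ)) (𝓕 u)) 2 volume] with ξ h
  rw [h, SchwartzMap.smulLeftCLM_apply_apply (hasTemperateGrowth_omegam_rpow hm s),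
    SchwartzMap.fourier_coe, RCLike.inner_apply, smul_eq_mul, mul_comm]

/-- The square of the dispersion symbol is the symbol of a local operator. -/
theorem exists_fourier_eq_omegam_sq_mul (m : ℝ) (u : 𝓢(E3, ℂ)) :
    ∃ v : 𝓢(E3, ℂ), tsupport v ⊆ tsupport u ∧
      ∀ ξ, 𝓕 (v : E3 → ℂ) ξ = ((omegam m ξ ^ 2 : ℝ) : ℂ) * 𝓕 (u : E3 → ℂ) ξ := by
  let b := EuclideanSpace.basisFun (Fin 3) ℝ
  refine ⟨((m ^ 2 : ℝ) : ℂ) • u - (((4 * Real.pi ^ 2)⁻¹ : ℝ) : ℂ) • ∑ i, ∂_{b i} (∂_{b i} u),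
    closure_minimal (fun x hx => ?_) (isClosed_tsupport _), fun ξ => ?_⟩
  · by_contra h
    refine hx ?_
    have h1 (i : Fin 3) : ∂_{b i} (∂_{b i} u) x = 0 := image_eq_zero_of_notMem_tsupport fun h2 =>
      h (SchwartzMap.tsupport_lineDerivOp_subset _ _ (SchwartzMap.tsupport_lineDerivOp_subset _ _ h2))
    simp [h1, image_eq_zero_of_notMem_tsupport h]
  · have hg (i : Fin 3) : Function.HasTemperateGrowth (fun ξ : E3 => inner ℝ ξ (b i)) :=
      ((innerSL ℝ).flip (b i)).hasTemperateGrowth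
    have h1 (i : Fin 3) : 𝓕 (∂_{b i} (∂_{b i} u)) ξ =
        -(4 * Real.pi ^ 2) * (inner ℝ ξ (b i) ^ 2 : ℝ) * 𝓕 u ξ := by
      rw [SchwartzMap.fourier_lineDerivOp_eq, _root_.smul_apply,
        SchwartzMap.smulLeftCLM_apply_apply (hg i), SchwartzMap.fourier_lineDerivOp_eq,
        _root_.smul_apply, SchwartzMap.smulLeftCLM_apply_apply (hg i)]
      simp only [smul_eq_mul, real_smul]
      push_cast
      linear_combination (4 * Real.pi ^ 2 * (inner ℝ ξ (b i) : ℂ) ^ 2 * 𝓕 u ξ) * Complex.I_sq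
    have h2 : ∑ i, (inner ℝ ξ (b i)) ^ 2 = ‖ξ‖ ^ 2 := b.sum_sq_inner_left ξ
    rw [← SchwartzMap.fourier_coe, ← SchwartzMap.fourier_coe, sub_eq_add_neg, ← neg_smul,
      FourierTransform.fourier_add, FourierTransform.fourier_smul, FourierTransform.fourier_smul]
    have h3 : 𝓕 (∑ i, ∂_{b i} (∂_{b i} u)) = ∑ i, 𝓕 (∂_{b i} (∂_{b i} u)) :=
      map_sum (FourierTransform.fourierCLM ℂ 𝓢(E3, ℂ)) _ _
    rw [h3, omegam_sq, ← h2]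
    simp only [_root_.add_apply, _root_.smul_apply, _root_.sum_apply, h1,
      smul_eq_mul]
    rw [← Finset.sum_mul, ← Finset.mul_sum, ← ofReal_sum]
    have hpi : (Real.pi : ℂ) ≠ 0 := by exact_mod_cast Real.pi_ne_zero
    push_cast
    field_simp
    ring

theorem inner_toLp_HpowSchwartz_eq_zero_of_real {m s : ℝ} {G : Set E3}
    (f : Lp ℂ 2 (volume : Measure E3))
    (h : ∀ u : E3 → ℝ, ∀ hu : ContDiff ℝ (⊤ : ℕ∞) (fun x => (u x : ℂ)),
      ∀ hc : HasCompactSupport (fun x => (u x : ℂ)),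
      tsupport u ⊆ G → inner ℂ f ((HpowSchwartz m s (hc.toSchwartzMap hu)).toLp 2 volume) = 0)
    (u : 𝓢(E3, ℂ)) (hc : HasCompactSupport u) (huG : tsupport u ⊆ G) :
    inner ℂ f ((HpowSchwartz m s u).toLp 2 volume) = 0 := by
  have hadd (v w : 𝓢(E3, ℂ)) : HpowSchwartz m s (v + I • w) =
      HpowSchwartz m s v + I • HpowSchwartz m s w := by
    simp only [HpowSchwartz, FourierTransform.fourier_add, FourierTransform.fourier_smul, map_add,
      map_smul, FourierTransform.fourierInv_add, FourierTransform.fourierInv_smul]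
  have hLp (v w : 𝓢(E3, ℂ)) : (v + I • w).toLp 2 volume =
      v.toLp 2 volume + I • w.toLp 2 (volume : Measure E3) := by
    have := map_add (SchwartzMap.toLpCLM ℂ ℂ 2 (volume : Measure E3)) v (I • w)
    rwa [map_smul] at this
  have key (L : ℂ →L[ℝ] ℝ) : ∃ hu : ContDiff ℝ (⊤ : ℕ∞) (fun x => (L (u x) : ℂ)),
      ∃ hc : HasCompactSupport (fun x => (L (u x) : ℂ)),
      inner ℂ f ((HpowSchwartz m s (hc.toSchwartzMap hu)).toLp 2 volume) = 0 := by
    have hu : ContDiff ℝ (⊤ : ℕ∞) (fun x => (L (u x) : ℂ)) :=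
      ofRealCLM.contDiff.comp (L.contDiff.comp (u.smooth _))
    have hc' : HasCompactSupport (fun x => (L (u x) : ℂ)) :=
      hc.comp_left (g := fun z => (L z : ℂ)) (by simp)
    exact ⟨hu, hc', h _ hu hc' ((tsupport_comp_subset (map_zero L) _).trans huG)⟩
  obtain ⟨h1, h2, h3⟩ := key reCLM
  obtain ⟨h1', h2', h3'⟩ := key imCLM
  have hu : u = h2.toSchwartzMap h1 + I • h2'.toSchwartzMap h1' := by
    ext x
    simp [mul_comm I, re_add_im]
  rw [hu, hadd, hLp, inner_add_right, inner_smul_right, h3, h3']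
  simp

theorem integral_mul_omegam_pow_eq_zero {m : ℝ} {G : Set E3} {F : E3 → ℂ} {σ : E3 → ℂ}
    (h : ∀ u : 𝓢(E3, ℂ), HasCompactSupport u → tsupport u ⊆ G →
      ∫ ξ, F ξ * (σ ξ * 𝓕 (u : E3 → ℂ) ξ) = 0)
    (j : ℕ) (u : 𝓢(E3, ℂ)) (hc : HasCompactSupport u) (huG : tsupport u ⊆ G) :
    ∫ ξ, F ξ * (σ ξ * ((omegam m ξ : ℂ) ^ (2 * j) * 𝓕 (u : E3 → ℂ) ξ)) = 0 := by
  induction j generalizing u with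
  | zero => simpa using h u hc huG
  | succ j ih =>
    obtain ⟨v, hv, hv'⟩ := exists_fourier_eq_omegam_sq_mul m u
    rw [← ih v (hc.of_isClosed_subset (isClosed_tsupport _) hv) (hv.trans huG)]
    congr with ξ
    rw [hv']
    push_cast
    ring

theorem exp_neg_mul_sqrt_le {b : ℝ} (hb : 0 < b) {r : ℝ} (hr : 0 ≤ r) :
    Real.exp (-(b * √r)) ≤ Real.exp b * (Nat.factorial 8 / b ^ 8) * (1 + r) ^ (-4 : ℝ) := by
  have h1 := Real.pow_div_factorial_le_exp (x := b * (1 + √r)) (by positivity) 8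
  have h2 : (1 + r) ^ 4 ≤ (1 + √r) ^ 8 := by
    have : 1 + r ≤ (1 + √r) ^ 2 := by nlinarith [Real.sq_sqrt hr, Real.sqrt_nonneg r]
    calc (1 + r) ^ 4 ≤ ((1 + √r) ^ 2) ^ 4 := by gcongr
      _ = _ := by ring
  have h3 : b ^ 8 * (1 + r) ^ 4 / Nat.factorial 8 ≤ Real.exp (b * (1 + √r)) := by
    refine le_trans ?_ h1
    rw [mul_pow]
    gcongr
  have h4 : Real.exp (-(b * √r)) * Real.exp (b * (1 + √r)) = Real.exp b := by
    rw [← Real.exp_add]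
    ring_nf
  have h5 : (1 + r) ^ (-4 : ℝ) = ((1 + r) ^ 4)⁻¹ := by
    rw [Real.rpow_neg (by positivity)]
    norm_cast
  have h6 : Real.exp (-(b * √r)) * (b ^ 8 * (1 + r) ^ 4 / Nat.factorial 8) ≤ Real.exp b := by
    rw [← h4]
    gcongr
  have h7 : (0 : ℝ) < Nat.factorial 8 := by positivity
  have h8 : 0 < b ^ 8 * (1 + r) ^ 4 / Nat.factorial 8 := by positivity
  rw [h5]
  calc _ ≤ Real.exp b / (b ^ 8 * (1 + r) ^ 4 / Nat.factorial 8) := (le_div_iff₀ h8).2 h6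
    _ = _ := by
      field_simp

theorem memLp_exp_neg_mul_sqrt {b : ℝ} (hb : 0 < b) :
    MemLp (fun ξ : E3 => Real.exp (-(b * √‖ξ‖))) 2 volume := by
  rw [memLp_two_iff_integrable_sq (by fun_prop)]
  have h : Integrable fun ξ : E3 => (1 + ‖ξ‖) ^ (-4 : ℝ) :=
    integrable_one_add_norm (by simp; norm_num)
  refine (h.const_mul (Real.exp (2 * b) * (Nat.factorial 8 / (2 * b) ^ 8))).mono'
    (by fun_prop) (ae_of_all _ fun ξ => ?_)
  have := exp_neg_mul_sqrt_le (b := 2 * b) (by positivity) (norm_nonneg ξ)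
  rw [Real.norm_of_nonneg (by positivity), ← Real.exp_nat_mul]
  convert this using 2
  push_cast
  ring

theorem integrable_mul_of_norm_le_exp {F g : E3 → ℂ} (hF : MemLp F 2 volume)
    (hg : AEStronglyMeasurable g volume) {b C : ℝ} (hb : 0 < b)
    (hgC : ∀ ξ, ‖g ξ‖ ≤ C * Real.exp (-(b * √‖ξ‖))) : Integrable fun ξ => F ξ * g ξ := by
  have hg2 : MemLp g 2 volume :=
    ((memLp_exp_neg_mul_sqrt hb).const_mul C).mono' hg (ae_of_all _ hgC)
  exact hF.integrable_mul hg2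

/-- An integrable function with vanishing Fourier transform is zero. -/
theorem ae_eq_zero_of_fourier_eq_zero {g : E3 → ℂ} (hg : Integrable g)
    (h : ∀ p, 𝓕 g p = 0) : ∀ᵐ ξ, g ξ = 0 := by
  refine ae_eq_zero_of_integral_contDiff_smul_eq_zero hg.locallyIntegrable fun χ hχ hc => ?_
  have hχ' : ContDiff ℝ (⊤ : ℕ∞) (fun x => (χ x : ℂ)) := ofRealCLM.contDiff.comp hχ
  have hc' : HasCompactSupport (fun x => (χ x : ℂ)) :=
    hc.comp_left (g := fun t : ℝ => (t : ℂ)) (by simp)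
  let ψ : 𝓢(E3, ℂ) := 𝓕⁻ (hc'.toSchwartzMap hχ')
  have hψ (x : E3) : 𝓕 (ψ : E3 → ℂ) x = χ x := by
    rw [← SchwartzMap.fourier_coe, FourierTransform.fourier_fourierInv_eq]
    rfl
  have h1 : ∫ x, 𝓕 (ψ : E3 → ℂ) x • g x = ∫ x, (ψ : E3 → ℂ) x • 𝓕 g x := by
    simpa using! (VectorFourier.integral_fourierIntegral_smul_eq_flip (L := innerₗ E3)
      Real.continuous_fourierChar continuous_inner ψ.integrable hg)
  simp only [h, hψ, smul_zero, integral_zero] at h1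
  simpa using h1

/-- The cube bump as a Schwartz function. -/
def cubeBumpSchwartz {ε : ℝ} (hε : 0 < ε) (p : E3) : 𝓢(E3, ℂ) :=
  HasCompactSupport.toSchwartzMap
    ((isCompact_closedBall p (2 * ε)).of_isClosed_subset (isClosed_tsupport _)
      (tsupport_cubeBump_subset hε p)) (contDiff_cubeBump ε p)

theorem coe_cubeBumpSchwartz {ε : ℝ} (hε : 0 < ε) (p : E3) :
    ⇑(cubeBumpSchwartz hε p) = cubeBump ε p := rfl

theorem continuous_fourier_cubeBump {ε : ℝ} (hε : 0 < ε) (p : E3) :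
    Continuous (𝓕 (cubeBump ε p)) := by
  rw [← coe_cubeBumpSchwartz hε, ← SchwartzMap.fourier_coe]
  exact SchwartzMap.continuous _

theorem continuous_omegam_rpow {m : ℝ} (hm : 0 < m) (s : ℝ) :
    Continuous fun ξ : E3 => ((omegam m ξ ^ s : ℝ) : ℂ) :=
  continuous_ofReal.comp
    ((continuous_omegam m).rpow_const fun ξ => Or.inl (omegam_pos hm ξ).ne')

theorem integrable_mul_fourier_cubeBump {m : ℝ} (hm : 0 < m) {F : E3 → ℂ} (hF : MemLp F 2 volume)
    {ε : ℝ} (hε : 0 < ε) (p : E3) {c : ℝ} (hc : c ≤ √ε / 4) :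
    Integrable fun ξ => F ξ * (((omegam m ξ ^ (-(1 / 2) : ℝ) : ℝ) : ℂ) * 𝓕 (cubeBump ε p) ξ) *
      (Real.exp (c * |√(omegam m ξ)|) : ℂ) := by
  have hcont := continuous_omegam m
  simp_rw [mul_assoc (F _)]
  refine integrable_mul_of_norm_le_exp hF (b := √ε / 4)
    (C := m ^ (-(1 / 2) : ℝ) * (4 * ε) ^ 3 * Real.exp (√ε / 4 * √m)) ?_ (by positivity) fun ξ => ?_
  · exact Continuous.aestronglyMeasurable (((continuous_omegam_rpow hm _).mul
      (continuous_fourier_cubeBump hε p)).mul (continuous_ofReal.comp (by fun_prop)))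
  · rw [norm_mul, norm_mul, norm_real, norm_real, Real.norm_of_nonneg (Real.exp_pos _).le,
      Real.norm_of_nonneg (Real.rpow_nonneg (omegam_pos hm ξ).le _), abs_of_nonneg (Real.sqrt_nonneg _)]
    have h1 : omegam m ξ ^ (-(1 / 2) : ℝ) ≤ m ^ (-(1 / 2) : ℝ) :=
      Real.rpow_le_rpow_of_nonpos hm (le_omegam m ξ) (by norm_num)
    have h2 : √(omegam m ξ) ≤ √‖ξ‖ + √m := by
      refine Real.sqrt_le_iff.2 ⟨by positivity, (omegam_le hm ξ).trans ?_⟩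
      nlinarith [Real.sq_sqrt (norm_nonneg ξ), Real.sq_sqrt hm.le,
        mul_nonneg (Real.sqrt_nonneg ‖ξ‖) (Real.sqrt_nonneg m)]
    have h3 : c * √(omegam m ξ) ≤ √ε / 4 * (√‖ξ‖ + √m) := by gcongr
    calc _ ≤ m ^ (-(1 / 2) : ℝ) * ((4 * ε) ^ 3 * Real.exp (-(√(ε * ‖ξ‖) / 2))) *
          Real.exp (√ε / 4 * (√‖ξ‖ + √m)) := by
          gcongr
          exact norm_fourier_cubeBump_le hε p ξ
      _ = _ := by
          rw [Real.sqrt_mul hε.le, mul_assoc, mul_assoc, ← Real.exp_add, mul_assoc, mul_assoc,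
            ← Real.exp_add]
          ring_nf

theorem integral_mul_fourier_cubeBump_mul_exp_eq_zero {m : ℝ} (hm : 0 < m) {G : Set E3}
    {F : E3 → ℂ} (hF : MemLp F 2 volume)
    (h : ∀ s : ℝ, s = 1 / 2 ∨ s = -(1 / 2) → ∀ u : 𝓢(E3, ℂ), HasCompactSupport u →
      tsupport u ⊆ G → ∫ ξ, F ξ * (((omegam m ξ ^ s : ℝ) : ℂ) * 𝓕 (u : E3 → ℂ) ξ) = 0)
    {ε : ℝ} (hε : 0 < ε) {p : E3} (hp : Metric.closedBall p (2 * ε) ⊆ G) :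
    ∫ ξ, F ξ * (((omegam m ξ ^ (-(1 / 2) : ℝ) : ℝ) : ℂ) * 𝓕 (cubeBump ε p) ξ) *
      (Real.exp (-(omegam m ξ / 4)) : ℂ) = 0 := by
  have hsupp := tsupport_cubeBump_subset hε p
  have hc : HasCompactSupport (cubeBumpSchwartz hε p) :=
    (isCompact_closedBall p (2 * ε)).of_isClosed_subset (isClosed_tsupport _) hsupp
  have hmom (k : ℕ) : ∫ ξ, F ξ * (((omegam m ξ ^ (-(1 / 2) : ℝ) : ℝ) : ℂ) *
      𝓕 (cubeBump ε p) ξ) * ((√(omegam m ξ) : ℂ) ^ (2 * k)) = 0 := by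
    have hsq (ξ : E3) : ((√(omegam m ξ) : ℝ) : ℂ) ^ 2 = (omegam m ξ : ℂ) := by
      exact_mod_cast Real.sq_sqrt (omegam_pos hm ξ).le
    simp_rw [pow_mul, hsq]
    obtain ⟨j, rfl | rfl⟩ := Nat.even_or_odd' k
    · rw [← integral_mul_omegam_pow_eq_zero (h _ (Or.inr rfl)) j _ hc (hsupp.trans hp)]
      congr with ξ
      rw [coe_cubeBumpSchwartz]
      ring
    · rw [← integral_mul_omegam_pow_eq_zero (h _ (Or.inl rfl)) j _ hc (hsupp.trans hp)]
      congr with ξ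
      have : omegam m ξ ^ (1 / 2 : ℝ) = omegam m ξ ^ (-(1 / 2) : ℝ) * omegam m ξ := by
        rw [← Real.rpow_add_one (omegam_pos hm ξ).ne']
        norm_num
      rw [coe_cubeBumpSchwartz, this]
      push_cast
      ring
  have hX : Measurable fun ξ : E3 => √(omegam m ξ) := (continuous_omegam m).sqrt.measurable
  have h0 := integral_mul_exp_neg_sq_eq_zero hX (c := √ε / 4) (by positivity)
    (integrable_mul_fourier_cubeBump hm hF hε p le_rfl)
    (by simpa using integrable_mul_fourier_cubeBump hm hF hε p (c := 0) (by positivity)) hmom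
  simpa only [Real.sq_sqrt (omegam_pos hm _).le] using h0

theorem fourier_cubeBump_add {ε : ℝ} (hε : 0 < ε) (p a ξ : E3) :
    𝓕 (cubeBump ε (p + a)) ξ =
      𝓕 (cubeBump ε p) ξ * cexp (I * ((-(2 * Real.pi * inner ℝ a ξ) : ℝ) : ℂ)) := by
  rw [fourier_cubeBump hε, fourier_cubeBump hε, inner_add_left, mul_right_comm (cexp _),
    ← Complex.exp_add]
  congr 2
  push_cast
  ring

theorem ae_mul_fourier_cubeBump_eq_zero {m : ℝ} (hm : 0 < m) {G : Set E3}
    {F : E3 → ℂ} (hF : MemLp F 2 volume)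
    (h : ∀ s : ℝ, s = 1 / 2 ∨ s = -(1 / 2) → ∀ u : 𝓢(E3, ℂ), HasCompactSupport u →
      tsupport u ⊆ G → ∫ ξ, F ξ * (((omegam m ξ ^ s : ℝ) : ℂ) * 𝓕 (u : E3 → ℂ) ξ) = 0)
    {ε : ℝ} (hε : 0 < ε) {p : E3} (hp : Metric.closedBall p (3 * ε) ⊆ G) :
    ∀ᵐ ξ, F ξ * 𝓕 (cubeBump ε p) ξ = 0 := by
  set w : E3 → ℂ := fun ξ => F ξ * (((omegam m ξ ^ (-(1 / 2) : ℝ) : ℝ) : ℂ) *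
    𝓕 (cubeBump ε p) ξ) * (Real.exp (-(omegam m ξ / 4)) : ℂ) with hw
  have hcont := continuous_omegam m
  have hw' : Integrable fun ξ => w ξ * (Real.exp (1 / 4 * ‖ξ‖) : ℂ) := by
    have h0 := integrable_mul_fourier_cubeBump hm hF hε p (c := 0) (by positivity)
    simp only [zero_mul, Real.exp_zero, ofReal_one, mul_one] at h0
    simp_rw [hw, mul_assoc (F _ * _)]
    refine h0.mul_bdd (c := 1) (Continuous.aestronglyMeasurable (by fun_prop))
      (ae_of_all _ fun ξ => ?_)
    rw [← ofReal_mul, ← Real.exp_add, norm_real, Real.norm_of_nonneg (Real.exp_pos _).le,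
      Real.exp_le_one_iff]
    linarith [norm_le_omegam m ξ]
  have hzero (a : E3) : ∫ ξ, w ξ * cexp (I * ((-(2 * Real.pi * inner ℝ a ξ) : ℝ) : ℂ)) = 0 := by
    let X : E3 → ℝ := fun ξ => -(2 * Real.pi * inner ℝ a ξ)
    have hX : Measurable X := Continuous.measurable (by fun_prop)
    obtain ⟨c, hc, hcX⟩ : ∃ c > 0, ∀ ξ, c * |X ξ| ≤ 1 / 4 * ‖ξ‖ := by
      refine ⟨1 / 4 / (2 * Real.pi * (‖a‖ + 1)), by positivity, fun ξ => ?_⟩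
      have h1 : |X ξ| ≤ 2 * Real.pi * (‖a‖ + 1) * ‖ξ‖ := by
        simp only [X, abs_neg, abs_mul, abs_of_pos Real.pi_pos, abs_two]
        have := abs_real_inner_le_norm a ξ
        rw [mul_assoc (2 * Real.pi)]
        gcongr
        nlinarith [norm_nonneg ξ]
      rw [div_mul_eq_mul_div, div_le_iff₀ (by positivity)]
      linarith
    have hint : Integrable fun ξ => w ξ * (Real.exp (c * |X ξ|) : ℂ) := by
      have h1 (ξ : E3) : w ξ * (Real.exp (c * |X ξ|) : ℂ) =
          w ξ * (Real.exp (1 / 4 * ‖ξ‖) : ℂ) * (Real.exp (c * |X ξ| - 1 / 4 * ‖ξ‖) : ℂ) := by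
        rw [mul_assoc (w ξ), ← ofReal_mul, ← Real.exp_add]
        ring_nf
      simp_rw [h1]
      refine hw'.mul_bdd (c := 1) (Measurable.aestronglyMeasurable (by fun_prop))
        (ae_of_all _ fun ξ => ?_)
      rw [norm_real, Real.norm_of_nonneg (Real.exp_pos _).le, Real.exp_le_one_iff]
      linarith [hcX ξ]
    have h1 := eq_zero_of_analyticOnNhd_strip hc (analyticOnNhd_integral_mul_cexp hX hint) ?_ 1
    · simpa [X] using h1
    have h2 : ∀ᶠ t : ℝ in 𝓝 0, ‖t • a‖ < ε :=
      (by fun_prop : Continuous fun t : ℝ => ‖t • a‖).continuousAt.eventually_lt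
        continuousAt_const (by simpa using hε)
    filter_upwards [h2] with t ht
    have h3 : Metric.closedBall (p + t • a) (2 * ε) ⊆ G := by
      refine (Metric.closedBall_subset_closedBall' ?_).trans hp
      rw [dist_eq_norm, add_sub_cancel_left]
      linarith
    rw [← integral_mul_fourier_cubeBump_mul_exp_eq_zero hm hF h hε h3]
    congr with ξ
    rw [fourier_cubeBump_add hε, hw]
    simp only [X, real_inner_smul_left]
    rw [show I * (t : ℂ) * ((-(2 * Real.pi * inner ℝ a ξ) : ℝ) : ℂ) =
      I * ((-(2 * Real.pi * (t * inner ℝ a ξ)) : ℝ) : ℂ) by push_cast; ring]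
    ring
  have hwint : Integrable w := by
    refine (hw'.mul_bdd (c := 1) (g := fun ξ => (Real.exp (-(1 / 4 * ‖ξ‖)) : ℂ))
      (Continuous.aestronglyMeasurable (by fun_prop)) (ae_of_all _ fun ξ => ?_)).congr
      (ae_of_all _ fun ξ => ?_)
    · rw [norm_real, Real.norm_of_nonneg (Real.exp_pos _).le, Real.exp_le_one_iff]
      linarith [norm_nonneg ξ]
    · simp only
      rw [mul_assoc, ← ofReal_mul, ← Real.exp_add]
      simp
  have hfour : ∀ a, 𝓕 w a = 0 := fun a => by
    rw [Real.fourier_eq', ← hzero a]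
    congr with ξ
    rw [smul_eq_mul, mul_comm, real_inner_comm, mul_comm I]
    ring_nf
  filter_upwards [ae_eq_zero_of_fourier_eq_zero hwint hfour] with ξ hξ
  have h1 : omegam m ξ ^ (-(1 / 2) : ℝ) ≠ 0 := (Real.rpow_pos_of_pos (omegam_pos hm ξ) _).ne'
  have h2 := Real.exp_ne_zero (-(omegam m ξ / 4))
  have h3 := (mul_eq_zero.1 hξ).resolve_right (ofReal_ne_zero.2 h2)
  rw [mul_left_comm] at h3
  exact (mul_eq_zero.1 h3).resolve_left (ofReal_ne_zero.2 h1)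

theorem ae_eq_zero_of_forall_orthogonal {m : ℝ} (hm : 0 < m) {G : Set E3} (hG : IsOpen G)
    (hGne : G.Nonempty) {F : E3 → ℂ} (hF : MemLp F 2 volume)
    (h : ∀ s : ℝ, s = 1 / 2 ∨ s = -(1 / 2) → ∀ u : 𝓢(E3, ℂ), HasCompactSupport u →
      tsupport u ⊆ G → ∫ ξ, F ξ * (((omegam m ξ ^ s : ℝ) : ℂ) * 𝓕 (u : E3 → ℂ) ξ) = 0) :
    ∀ᵐ ξ, F ξ = 0 := by
  obtain ⟨p, hp⟩ := hGne
  obtain ⟨r, hr, hrG⟩ := Metric.nhds_basis_closedBall.mem_iff.1 (hG.mem_nhds hp)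
  let ε : ℕ → ℝ := fun n => r / 3 * (1 / ((n : ℝ) + 1))
  have hε (n : ℕ) : 0 < ε n := by positivity
  have hε' (n : ℕ) : 3 * ε n ≤ r := by
    have h1 : 1 / ((n : ℝ) + 1) ≤ 1 := (div_le_one (by positivity)).2 (by simp)
    have : ε n ≤ r / 3 * 1 := by simp only [ε]; gcongr
    linarith
  have hlim : Tendsto ε atTop (𝓝[>] 0) := by
    refine tendsto_nhdsWithin_iff.2 ⟨?_, Eventually.of_forall hε⟩
    simpa [ε] using tendsto_one_div_add_atTop_nhds_zero_nat.const_mul (r / 3)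
  have hall : ∀ᵐ ξ, ∀ n, F ξ * 𝓕 (cubeBump (ε n) p) ξ = 0 := ae_all_iff.2 fun n =>
    ae_mul_fourier_cubeBump_eq_zero hm hF h (hε n) ((Metric.closedBall_subset_closedBall (hε' n)).trans hrG)
  filter_upwards [hall] with ξ hξ
  obtain ⟨n, hn⟩ := (hlim.eventually (eventually_fourier_cubeBump_ne_zero p ξ)).exists
  exact (mul_eq_zero.1 (hξ n)).resolve_right hn

theorem Hpow_zero (m s : ℝ) : Hpow m s (fun _ => 0) = 0 := by
  have h : 𝓕 (fun _ : E3 => (0 : ℂ)) = 0 := by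
    ext ξ
    simp [Real.fourier_eq']
  ext x
  simp [Hpow, h, Real.fourierInv_eq']

/-- one-particle Reeh–Schlieder for the standard localization scheme:
for `m > 0` and any nonempty open `G ⊆ ℝ³`, the `ℂ`-linear span of the elements of
`L²(ℝ³;ℂ)` represented by `H^{1/2}u + i·H^{−1/2}v`, for `u, v` smooth compactly supported
real-valued functions supported in `G`, is dense in `L²(ℝ³;ℂ)`. -/
theorem span_NW_image_dense (m : ℝ) (hm : 0 < m)
    (G : Set E3) (hG : IsOpen G) (hGne : G.Nonempty) :
    Dense (↑(Submodule.span ℂ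
      {g : Lp ℂ 2 (volume : Measure E3) | ∃ u v : E3 → ℝ,
        ContDiff ℝ (⊤ : ℕ∞) u ∧ HasCompactSupport u ∧ tsupport u ⊆ G ∧
        ContDiff ℝ (⊤ : ℕ∞) v ∧ HasCompactSupport v ∧ tsupport v ⊆ G ∧
        (g : E3 → ℂ) =ᵐ[volume] fun x =>
          Hpow m (1 / 2) (fun y => (u y : ℂ)) x +
            Complex.I * Hpow m (-(1 / 2)) (fun y => (v y : ℂ)) x}) :
      Set (Lp ℂ 2 (volume : Measure E3))) := by
  rw [Submodule.dense_iff_topologicalClosure_eq_top, Submodule.topologicalClosure_eq_top_iff,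
    Submodule.eq_bot_iff]
  intro f hf
  have horth := (Submodule.mem_orthogonal _ f).1 hf
  have hreal (s : ℝ) (hs : s = 1 / 2 ∨ s = -(1 / 2)) (u : E3 → ℝ)
      (hu : ContDiff ℝ (⊤ : ℕ∞) (fun x => (u x : ℂ)))
      (hc : HasCompactSupport (fun x => (u x : ℂ))) (huG : tsupport u ⊆ G) :
      inner ℂ f ((HpowSchwartz m s (hc.toSchwartzMap hu)).toLp 2 volume) = 0 := by
    have hu' : ContDiff ℝ (⊤ : ℕ∞) u := reCLM.contDiff.comp hu
    have hc' : HasCompactSupport u := hc.comp_left (g := Complex.re) rfl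
    have h0 : tsupport (fun _ : E3 => (0 : ℝ)) ⊆ G := by simp [tsupport]
    have h0c : HasCompactSupport (fun _ : E3 => (0 : ℝ)) := HasCompactSupport.zero
    have hcoe := SchwartzMap.coeFn_toLp (HpowSchwartz m s (hc.toSchwartzMap hu)) 2
      (volume : Measure E3)
    rw [coe_HpowSchwartz hm] at hcoe
    rcases hs with rfl | rfl
    · rw [inner_eq_zero_symm]
      refine horth _ (Submodule.subset_span
        ⟨u, fun _ => 0, hu', hc', huG, contDiff_const, h0c, h0, ?_⟩)
      filter_upwards [hcoe] with x hx
      simp only [ofReal_zero, Hpow_zero, Pi.zero_apply, mul_zero, add_zero]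
      exact hx
    · have h1 : inner ℂ (I • (HpowSchwartz m (-(1 / 2)) (hc.toSchwartzMap hu)).toLp 2 volume) f
          = 0 := by
        refine horth _ (Submodule.subset_span
          ⟨fun _ => 0, u, contDiff_const, h0c, h0, hu', hc', huG, ?_⟩)
        filter_upwards [hcoe, Lp.coeFn_smul I
          ((HpowSchwartz m (-(1 / 2)) (hc.toSchwartzMap hu)).toLp 2 volume)] with x hx hx'
        simp only [ofReal_zero, Hpow_zero, Pi.zero_apply, zero_add]
        rw [hx', Pi.smul_apply, hx, smul_eq_mul]
        rfl
      rw [inner_smul_left] at h1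
      rw [inner_eq_zero_symm]
      simpa using h1
  have hF : ∀ᵐ ξ, (starRingEnd ℂ) ((𝓕 f : Lp ℂ 2 (volume : Measure E3)) ξ) = 0 := by
    refine ae_eq_zero_of_forall_orthogonal hm hG hGne
      (Lp.memLp (𝓕 f : Lp ℂ 2 (volume : Measure E3))).star fun s hs u hc huG => ?_
    rw [← inner_toLp_HpowSchwartz_eq_zero_of_real f (hreal s hs) u hc huG,
      inner_toLp_HpowSchwartz hm]
  have hF0 : (𝓕 f : Lp ℂ 2 (volume : Measure E3)) = 0 := by
    rw [Lp.eq_zero_iff_ae_eq_zero]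
    filter_upwards [hF] with ξ hξ
    simpa using hξ
  rw [← norm_eq_zero, ← Lp.norm_fourier_eq, hF0, norm_zero]

end
end

section
/- Let μ be a finite complex measure on ℝ whose support is contained in [0, ∞) (i.e., μ(A) = 0 for every measurable A ⊆ (−∞, 0)). Suppose there are real numbers a < b such that ∫_ℝ e^{i t λ} dμ(λ) = 0 for every t with a < t < b. Then μ = 0. -/
open MeasureTheory Complex

noncomputable section

/-- The integral of a complex-valued function against a finite complex measure `μ`,
defined via the Jordan decompositions of the real and imaginary parts of `μ`:
`∫ f dμ = (∫ f dμ₁ − ∫ f dμ₂) + i(∫ f dμ₃ − ∫ f dμ₄)` where `Re μ = μ₁ − μ₂` and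
`Im μ = μ₃ − μ₄` are the Jordan decompositions. -/
def ComplexMeasure.integral {α : Type*} [MeasurableSpace α]
    (μ : MeasureTheory.ComplexMeasure α) (f : α → ℂ) : ℂ :=
  ((∫ x, f x ∂(MeasureTheory.ComplexMeasure.re μ).toJordanDecomposition.posPart) -
      (∫ x, f x ∂(MeasureTheory.ComplexMeasure.re μ).toJordanDecomposition.negPart)) +
    Complex.I *
      ((∫ x, f x ∂(MeasureTheory.ComplexMeasure.im μ).toJordanDecomposition.posPart) -
        (∫ x, f x ∂(MeasureTheory.ComplexMeasure.im μ).toJordanDecomposition.negPart))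

/-- A function continuous on the closed upper half-plane, holomorphic in its interior and zero on
the real interval `(a, b)` vanishes at the centre of every square which stands on a compact
subinterval of `(a, b)`: the product of its four rotations about the centre vanishes on the boundary
of the square. -/
theorem eq_zero_at_center_of_eq_zero_on_Ioo {F : ℂ → ℂ}
    (hc : ContinuousOn F {z | 0 ≤ z.im}) (hd : DifferentiableOn ℂ F {z | 0 < z.im})
    {a b : ℝ} (h0 : ∀ t : ℝ, a < t → t < b → F t = 0)
    {z₀ : ℂ} (hpos : 0 < z₀.im) (ha : a < z₀.re - z₀.im) (hb : z₀.re + z₀.im < b) :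
    F z₀ = 0 := by
  set c := z₀.re with hcdef
  set h := z₀.im with hhdef
  set Q : Set ℂ := Set.Ioo (c - h) (c + h) ×ℂ Set.Ioo 0 (2 * h) with hQ
  have hcl : closure Q = Set.Icc (c - h) (c + h) ×ℂ Set.Icc 0 (2 * h) := by
    rw [hQ, Complex.closure_reProdIm, closure_Ioo (by linarith), closure_Ioo (by linarith)]
  have hF : DiffContOnCl ℂ F Q := by
    refine ⟨hd.mono fun z hz => hz.2.1, hc.mono ?_⟩
    rw [hcl]
    exact fun z hz => hz.2.1
  have hrot : ∀ u : ℂ, u = 1 ∨ u = I ∨ u = -1 ∨ u = -I →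
      DiffContOnCl ℂ (fun z => F (z₀ + u * (z - z₀))) Q := by
    intro u hu
    refine hF.comp (g := fun z => z₀ + u * (z - z₀)) (Differentiable.diffContOnCl (by fun_prop)) ?_
    rintro z ⟨⟨h1, h2⟩, h3, h4⟩
    rcases hu with rfl | rfl | rfl | rfl <;>
    refine ⟨⟨?_, ?_⟩, ?_, ?_⟩ <;> simp [← hcdef, ← hhdef] <;> linarith
  have hH := ((hrot 1 (by simp)).smul (hrot I (by simp))).smul
    ((hrot (-1) (by simp)).smul (hrot (-I) (by simp)))
  have hbd : Bornology.IsBounded Q :=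
    (Metric.isBounded_Ioo _ _).reProdIm (Metric.isBounded_Ioo _ _)
  have hz₀ : z₀ ∈ Q := by
    refine ⟨⟨?_, ?_⟩, ?_, ?_⟩ <;> simp only [← hcdef, ← hhdef] <;> linarith
  have hbase : ∀ w : ℂ, c - h ≤ w.re → w.re ≤ c + h → w.im = 0 → F w = 0 := by
    intro w h1 h2 h3
    have : w = (w.re : ℂ) := Complex.ext (by simp) (by simp [h3])
    rw [this]
    exact h0 _ (by linarith) (by linarith)
  have key := Complex.eqOn_of_eqOn_frontier hbd hH (diffContOnCl_const (c := (0 : ℂ))) (by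
    intro z hz
    rw [hQ, Complex.frontier_reProdIm, closure_Ioo (by linarith), closure_Ioo (by linarith),
      frontier_Ioo (by linarith), frontier_Ioo (by linarith)] at hz
    simp only [Set.mem_union, Complex.mem_reProdIm, Set.mem_Icc, Set.mem_insert_iff,
      Set.mem_singleton_iff] at hz
    simp only [smul_eq_mul, mul_eq_zero]
    rcases hz with ⟨⟨h1, h2⟩, h3 | h3⟩ | ⟨h3 | h3, h1, h2⟩
    · left; left
      apply hbase <;> simp [← hcdef, ← hhdef] <;> linarith
    · right; left
      apply hbase <;> simp [← hcdef, ← hhdef] <;> linarith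
    · left; right
      apply hbase <;> simp [← hcdef, ← hhdef] <;> linarith
    · right; right
      apply hbase <;> simp [← hcdef, ← hhdef] <;> linarith) hz₀
  simpa using key

/-- Boundary uniqueness: a function continuous on the closed upper half-plane, holomorphic in its
interior and zero on a nonempty open real interval is identically zero. -/
theorem eq_zero_of_eq_zero_on_Ioo {F : ℂ → ℂ}
    (hc : ContinuousOn F {z | 0 ≤ z.im}) (hd : DifferentiableOn ℂ F {z | 0 < z.im})
    {a b : ℝ} (hab : a < b) (h0 : ∀ t : ℝ, a < t → t < b → F t = 0)
    {z : ℂ} (hz : 0 ≤ z.im) : F z = 0 := by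
  have hopen : IsOpen {z : ℂ | 0 < z.im} := isOpen_lt continuous_const Complex.continuous_im
  set z₀ : ℂ := ⟨(a + b) / 2, (b - a) / 4⟩ with hz₀
  have hev : F =ᶠ[nhds z₀] 0 := by
    have h1 : ∀ᶠ w : ℂ in nhds z₀, 0 < w.im :=
      Complex.continuous_im.continuousAt.eventually (lt_mem_nhds (by simp [hz₀]; linarith))
    have h2 : ∀ᶠ w : ℂ in nhds z₀, a < w.re - w.im :=
      (Complex.continuous_re.sub Complex.continuous_im).continuousAt.eventually
        (lt_mem_nhds (by simp [hz₀]; linarith))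
    have h3 : ∀ᶠ w : ℂ in nhds z₀, w.re + w.im < b :=
      (Complex.continuous_re.add Complex.continuous_im).continuousAt.eventually
        (gt_mem_nhds (by simp [hz₀]; linarith))
    filter_upwards [h1, h2, h3] with w h1 h2 h3
    exact eq_zero_at_center_of_eq_zero_on_Ioo hc hd h0 h1 h2 h3
  have hmem : z₀ ∈ {z : ℂ | 0 < z.im} := by
    simp only [Set.mem_ofPred_eq, hz₀]; linarith
  have hint : Set.EqOn F 0 {z : ℂ | 0 < z.im} :=
    (hd.analyticOnNhd hopen).eqOn_zero_of_preconnected_of_eventuallyEq_zero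
      (convex_halfSpace_im_gt 0).isPreconnected hmem hev
  refine hint.of_subset_closure hc continuousOn_const (fun w (hw : 0 < w.im) => hw.le) ?_ hz
  exact (Complex.closure_setOfPred_lt_im 0).ge

theorem norm_exp_I_mul_mul_ofReal (z : ℂ) (x : ℝ) :
    ‖Complex.exp (I * z * x)‖ = Real.exp (-(z.im * x)) := by
  simp [Complex.norm_exp]

theorem ae_nonneg_of_measure_Iio_eq_zero {ν : Measure ℝ} (hν : ν (Set.Iio 0) = 0) :
    ∀ᵐ x ∂ν, 0 ≤ x := by
  rw [ae_iff]
  simpa [Set.Iio] using hν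

/-- The Fourier–Laplace transform of a finite measure on `[0, ∞)` is continuous on the closed upper
half-plane. -/
theorem continuousOn_integral_exp_I_mul {ν : Measure ℝ} [IsFiniteMeasure ν]
    (hν : ν (Set.Iio 0) = 0) :
    ContinuousOn (fun z : ℂ => ∫ x : ℝ, Complex.exp (I * z * x) ∂ν) {z | 0 ≤ z.im} := by
  refine continuousOn_of_dominated (bound := fun _ => 1) ?_ ?_ (integrable_const _) ?_
  · exact fun z _ => Continuous.aestronglyMeasurable (by fun_prop)
  · intro z hz
    filter_upwards [ae_nonneg_of_measure_Iio_eq_zero hν] with x hx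
    rw [norm_exp_I_mul_mul_ofReal]
    exact Real.exp_le_one_iff.2 (neg_nonpos.2 (mul_nonneg hz hx))
  · exact Filter.Eventually.of_forall fun x => Continuous.continuousOn (by fun_prop)

/-- The Fourier–Laplace transform of a finite measure on `[0, ∞)` is holomorphic on the upper
half-plane. -/
theorem differentiableOn_integral_exp_I_mul {ν : Measure ℝ} [IsFiniteMeasure ν]
    (hν : ν (Set.Iio 0) = 0) :
    DifferentiableOn ℂ (fun z : ℂ => ∫ x : ℝ, Complex.exp (I * z * x) ∂ν) {z | 0 < z.im} := by
  have hsub : Set.Iio (0 : ℝ) ⊆ interior (ProbabilityTheory.integrableExpSet id ν) := by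
    refine interior_maximal (fun t ht => ?_) isOpen_Iio
    refine Integrable.of_bound (C := 1) (Continuous.aestronglyMeasurable (by fun_prop)) ?_
    filter_upwards [ae_nonneg_of_measure_Iio_eq_zero hν] with x hx
    rw [Real.norm_of_nonneg (Real.exp_pos _).le]
    exact Real.exp_le_one_iff.2 (mul_nonpos_of_nonpos_of_nonneg (le_of_lt ht) hx)
  refine (ProbabilityTheory.differentiableOn_complexMGF (X := id) (μ := ν)).comp
    (f := fun z : ℂ => I * z) (by fun_prop) fun z hz => hsub ?_
  simpa using hz

theorem posPart_eq_zero_of_forall_subset {α : Type*} [MeasurableSpace α] {s : SignedMeasure α}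
    {B : Set α} (hB : MeasurableSet B) (h : ∀ A, MeasurableSet A → A ⊆ B → s A = 0) :
    s.toJordanDecomposition.posPart B = 0 := by
  obtain ⟨S, hS, hpos, hneg⟩ := s.toJordanDecomposition.mutuallySingular
  have h1 := h (B ∩ Sᶜ) (hB.inter hS.compl) Set.inter_subset_left
  rw [s.apply_eq_posPart_real_sub_negPart_real (hB.inter hS.compl), measureReal_def,
    measureReal_def, measure_mono_null Set.inter_subset_right hneg, ENNReal.toReal_zero, sub_zero,
    ENNReal.toReal_eq_zero_iff, or_iff_left (measure_ne_top _ _)] at h1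
  rw [← Set.inter_union_compl B S]
  exact measure_union_null (measure_mono_null Set.inter_subset_right hpos) h1

theorem negPart_eq_zero_of_forall_subset {α : Type*} [MeasurableSpace α] {s : SignedMeasure α}
    {B : Set α} (hB : MeasurableSet B) (h : ∀ A, MeasurableSet A → A ⊆ B → s A = 0) :
    s.toJordanDecomposition.negPart B = 0 := by
  have := posPart_eq_zero_of_forall_subset (s := -s) hB fun A hA hAB => by simp [h A hA hAB]
  rwa [SignedMeasure.toJordanDecomposition_neg, JordanDecomposition.neg_posPart] at this

theorem signedMeasure_eq_zero_of_posPart_eq_negPart {α : Type*} [MeasurableSpace α]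
    {s : SignedMeasure α} (h : s.toJordanDecomposition.posPart = s.toJordanDecomposition.negPart) :
    s = 0 := by
  ext A hA
  rw [s.apply_eq_posPart_real_sub_negPart_real hA, h, sub_self, zero_apply]

/-- A finite complex measure on `ℝ` with vanishing Fourier–Stieltjes transform is zero. -/
theorem complexMeasure_eq_zero_of_fourier_eq_zero (μ : ComplexMeasure ℝ)
    (h : ∀ t : ℝ, ComplexMeasure.integral μ (fun lam => Complex.exp (I * t * lam)) = 0) :
    μ = 0 := by
  have hexp (ν : Measure ℝ) (t : ℝ) : ∫ x : ℝ, Complex.exp (I * t * x) ∂ν = charFun ν t := by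
    rw [charFun_apply_real]
    congr 1 with x
    ring_nf
  simp only [ComplexMeasure.integral, hexp] at h
  have hconj (t : ℝ) := congrArg (starRingEnd ℂ) (h (-t))
  simp only [map_add, map_sub, map_mul, Complex.conj_I, map_zero, charFun_neg,
    Complex.conj_conj] at hconj
  have hre : ComplexMeasure.re μ = 0 := by
    refine signedMeasure_eq_zero_of_posPart_eq_negPart (Measure.ext_of_charFun (funext fun t => ?_))
    linear_combination (h t + hconj t) / 2
  have him : ComplexMeasure.im μ = 0 := by
    refine signedMeasure_eq_zero_of_posPart_eq_negPart (Measure.ext_of_charFun (funext fun t => ?_))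
    refine mul_left_cancel₀ Complex.I_ne_zero ?_
    linear_combination (h t - hconj t) / 2
  rw [← μ.toComplexMeasure_to_signedMeasure, hre, him]
  rfl

/-- spectral-measure form of Kadison's little Reeh–Schlieder theorem:
let `μ` be a finite complex measure on `ℝ` supported in `[0, ∞)` (it vanishes on every
measurable subset of `(−∞, 0)`).  If its inverse Fourier–Stieltjes transform
`t ↦ ∫ e^{itλ} dμ(λ)` vanishes for all `t` in some nonempty interval `(a, b)`, then
`μ = 0`. -/
theorem complexMeasure_eq_zero_of_fourier_vanishes_on_interval
    (μ : MeasureTheory.ComplexMeasure ℝ)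
    (hsupp : ∀ A : Set ℝ, MeasurableSet A → A ⊆ Set.Iio (0 : ℝ) → μ A = 0)
    (a b : ℝ) (hab : a < b)
    (hvanish : ∀ t : ℝ, a < t → t < b →
      ComplexMeasure.integral μ (fun lam => Complex.exp (Complex.I * t * lam)) = 0) :
    μ = 0 := by
  have hre : ∀ A, MeasurableSet A → A ⊆ Set.Iio (0 : ℝ) → ComplexMeasure.re μ A = 0 :=
    fun A hA hA0 => congrArg Complex.re (hsupp A hA hA0)
  have him : ∀ A, MeasurableSet A → A ⊆ Set.Iio (0 : ℝ) → ComplexMeasure.im μ A = 0 :=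
    fun A hA hA0 => congrArg Complex.im (hsupp A hA hA0)
  have h1 := posPart_eq_zero_of_forall_subset measurableSet_Iio hre
  have h2 := negPart_eq_zero_of_forall_subset measurableSet_Iio hre
  have h3 := posPart_eq_zero_of_forall_subset measurableSet_Iio him
  have h4 := negPart_eq_zero_of_forall_subset measurableSet_Iio him
  have hc : ContinuousOn
      (fun z : ℂ => ComplexMeasure.integral μ fun lam => Complex.exp (I * z * lam))
      {z | 0 ≤ z.im} :=
    ((continuousOn_integral_exp_I_mul h1).sub (continuousOn_integral_exp_I_mul h2)).add
      (continuousOn_const.mul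
        ((continuousOn_integral_exp_I_mul h3).sub (continuousOn_integral_exp_I_mul h4)))
  have hd : DifferentiableOn ℂ
      (fun z : ℂ => ComplexMeasure.integral μ fun lam => Complex.exp (I * z * lam))
      {z | 0 < z.im} :=
    ((differentiableOn_integral_exp_I_mul h1).sub (differentiableOn_integral_exp_I_mul h2)).add
      (((differentiableOn_integral_exp_I_mul h3).sub
        (differentiableOn_integral_exp_I_mul h4)).const_mul I)
  exact complexMeasure_eq_zero_of_fourier_eq_zero μ fun t =>
    eq_zero_of_eq_zero_on_Ioo hc hd hab hvanish (z := (t : ℂ)) (by simp)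

end
end
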